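/- Let s and t be coprime positive integers. Then there is a unique (s,t)-core partition of largest size; this partition is self-conjugate and its size equals (s²−1)(t²−1)/24. -/

import Mathlib

/-- A partition, given by its (0-indexed) weakly decreasing sequence of parts,
which is eventually zero. Row `i` of the Young diagram has `parts i` cells;
the diagram consists of the (0-indexed) cells `(i, j)` with `j < parts i`. -/
structure YPartition where
  parts : ℕ → ℕ
  antitone : ∀ ⦃i j : ℕ⦄, i ≤ j → parts j ≤ parts i
  finite_support : ∃ N, ∀ i, N ≤ i → parts i = 0

namespace YPartition

/-- The `j`-th (0-indexed) part of the conjugate partition: the number of rows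
whose length exceeds `j`. -/
noncomputable def conj (p : YPartition) (j : ℕ) : ℕ := Set.ncard {i : ℕ | j < p.parts i}

/-- The set of (0-indexed) cells of the Young diagram. -/
def cells (p : YPartition) : Set (ℕ × ℕ) := {c | c.2 < p.parts c.1}

/-- The size of a partition: the number of cells of its Young diagram. -/
noncomputable def size (p : YPartition) : ℕ := p.cells.ncard

/-- The hook length of the (0-indexed) cell `(i, j)`:
`λ_i − j + λ'_j − i + 1` in 1-indexed terms. -/
noncomputable def hook (p : YPartition) (i j : ℕ) : ℕ := p.parts i + p.conj j - i - j - 1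

/-- A partition is self-conjugate if it equals its conjugate. -/
def SelfConj (p : YPartition) : Prop := ∀ j, p.conj j = p.parts j

/-- A partition is a `t`-core if no cell of its diagram has hook length `t`. -/
def IsCore (t : ℕ) (p : YPartition) : Prop :=
  ∀ i j : ℕ, (i, j) ∈ p.cells → p.hook i j ≠ t

/-- The set of hook lengths of the main diagonal cells. -/
def MD (p : YPartition) : Set ℕ := {h | ∃ i : ℕ, i < p.parts i ∧ h = p.hook i i}

end YPartition

namespace YPartition

/-- The beta numbers of a partition. -/
def beta (p : YPartition) (i : ℕ) : ℤ := (p.parts i : ℤ) - i - 1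

/-- The (infinite) beta set of a partition. -/
def bset (p : YPartition) : Set ℤ := Set.range p.beta

lemma ext_parts {p q : YPartition} (h : p.parts = q.parts) : p = q := by
  cases p; cases q; simp_all

lemma lt_conj_iff (p : YPartition) (i j : ℕ) : i < p.conj j ↔ j < p.parts i := by
  obtain ⟨N, hN⟩ := p.finite_support
  have hex : ∃ n, p.parts n ≤ j := ⟨N, by rw [hN N le_rfl]; omega⟩
  classical
  have key : {i : ℕ | j < p.parts i} = ((Finset.range (Nat.find hex) : Finset ℕ) : Set ℕ) := by
    ext k
    simp only [Set.mem_ofPred_eq, Finset.coe_range, Set.mem_Iio, Nat.lt_find_iff]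
    constructor
    · intro h m hm
      have := p.antitone hm
      omega
    · intro h
      have := h k le_rfl
      omega
  have hc : p.conj j = Nat.find hex := by
    unfold conj
    rw [key, Set.ncard_coe_finset, Finset.card_range]
  have : i ∈ {i : ℕ | j < p.parts i} ↔ i ∈ ((Finset.range (Nat.find hex) : Finset ℕ) : Set ℕ) := by
    rw [key]
  rw [hc]
  simpa using this.symm

lemma beta_strictAnti (p : YPartition) : StrictAnti p.beta := by
  intro i j hij
  have := p.antitone hij.le
  unfold beta
  omega

lemma eq_of_bset_eq {p q : YPartition} (h : p.bset = q.bset) : p = q := by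
  have hp : StrictMono (fun i => - p.beta i) := fun i j hij => by
    have := p.beta_strictAnti hij
    simpa using this
  have hq : StrictMono (fun i => - q.beta i) := fun i j hij => by
    have := q.beta_strictAnti hij
    simpa using this
  have hr : Set.range (fun i => - p.beta i) = Set.range (fun i => - q.beta i) := by
    ext x
    have := Set.ext_iff.mp h (-x)
    simp only [bset, Set.mem_range] at this ⊢
    constructor
    · rintro ⟨y, rfl⟩
      obtain ⟨z, hz⟩ := this.1 ⟨y, by simp⟩
      exact ⟨z, by simp [hz]⟩
    · rintro ⟨y, rfl⟩
      obtain ⟨z, hz⟩ := this.2 ⟨y, by simp⟩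
      exact ⟨z, by simp [hz]⟩
  have := (hp.range_inj hq).1 hr
  apply ext_parts
  funext i
  have h2 := congrFun this i
  simp only [beta] at h2
  omega

lemma beta_ne (p : YPartition) (i j : ℕ) : p.beta i ≠ (j : ℤ) - p.conj j := by
  have := p.lt_conj_iff i j
  unfold beta
  omega

lemma exists_of_notMem (p : YPartition) (x : ℤ) (hx : x ∉ p.bset) :
    ∃ j : ℕ, x = (j : ℤ) - p.conj j := by
  obtain ⟨N, hN⟩ := p.finite_support
  have hex : ∃ i, p.beta i < x := by
    refine ⟨N + x.natAbs, ?_⟩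
    unfold beta
    rw [hN _ (by omega)]
    omega
  classical
  obtain ⟨i, hi, hmin⟩ : ∃ i, p.beta i < x ∧ ∀ k < i, ¬ p.beta k < x :=
    ⟨Nat.find hex, Nat.find_spec hex, fun k hk => Nat.find_min hex hk⟩
  have h0 : 0 ≤ x + i := by
    unfold beta at hi
    omega
  obtain ⟨j, hj⟩ := Int.eq_ofNat_of_zero_le h0
  refine ⟨j, ?_⟩
  have h1 : ¬ i < p.conj j := by
    rw [lt_conj_iff]
    unfold beta at hi
    omega
  have h2 : ∀ k < i, k < p.conj j := by
    intro k hk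
    have hk1 : i - 1 < p.conj j := by
      rw [lt_conj_iff]
      have h3 := hmin (i - 1) (by omega)
      have h4 : p.beta (i - 1) ≠ x := fun h => hx ⟨_, h⟩
      unfold beta at h3 h4
      omega
    omega
  have h3 : p.conj j = i := by
    rcases Nat.eq_zero_or_pos i with h | h
    · omega
    · have := h2 (i - 1) (by omega)
      omega
  omega

lemma hook_eq (p : YPartition) {i j : ℕ} (h : j < p.parts i) :
    (p.hook i j : ℤ) = p.beta i - ((j : ℤ) - p.conj j) := by
  have := (p.lt_conj_iff i j).2 h
  unfold hook beta
  omega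

lemma isCore_iff (p : YPartition) (t : ℕ) (ht : 0 < t) :
    IsCore t p ↔ ∀ x ∈ p.bset, x - t ∈ p.bset := by
  constructor
  · rintro h x ⟨i, rfl⟩
    by_contra hx
    obtain ⟨j, hj⟩ := p.exists_of_notMem _ hx
    have hlt : j < p.parts i := by
      have := p.lt_conj_iff i j
      unfold beta at hj
      omega
    apply h i j hlt
    have := p.hook_eq hlt
    omega
  · intro h i j hij he
    have hlt : j < p.parts i := hij
    have := p.hook_eq hlt
    obtain ⟨k, hk⟩ := h _ ⟨i, rfl⟩
    apply p.beta_ne k j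
    omega

lemma size_eq (p : YPartition) (N : ℕ) (hN : ∀ i, N ≤ i → p.parts i = 0) :
    p.size = ∑ i ∈ Finset.range N, p.parts i := by
  have key : p.cells = (((Finset.range N) ×ˢ (Finset.range (p.parts 0))).filter
      (fun c => c.2 < p.parts c.1) : Finset (ℕ × ℕ)) := by
    ext ⟨i, j⟩
    simp only [cells, Set.mem_ofPred_eq, Finset.coe_filter, Finset.mem_product, Finset.mem_range]
    constructor
    · intro h
      have := p.antitone (Nat.zero_le i)
      refine ⟨⟨?_, by omega⟩, h⟩
      by_contra hc
      have := hN i (by omega)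
      omega
    · exact fun h => h.2
  unfold size
  rw [key, Set.ncard_coe_finset, Finset.card_filter, Finset.sum_product]
  refine Finset.sum_congr rfl fun i _ => ?_
  rw [← Finset.card_filter]
  have : (Finset.range (p.parts 0)).filter (fun j => j < p.parts i) = Finset.range (p.parts i) := by
    ext j
    have := p.antitone (Nat.zero_le i)
    simp only [Finset.mem_filter, Finset.mem_range]
    omega
  simp [this]

lemma mem_bset_of_lt (p : YPartition) (N : ℕ) (hN : ∀ i, N ≤ i → p.parts i = 0) (x : ℤ)
    (hx : x < -(N : ℤ)) : x ∈ p.bset := by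
  refine ⟨(-x - 1).toNat, ?_⟩
  unfold beta
  rw [hN _ (by omega)]
  omega

lemma mem_image_beta (p : YPartition) (N : ℕ) (hN : ∀ i, N ≤ i → p.parts i = 0) (x : ℤ) :
    x ∈ (Finset.range N).image p.beta ↔ x ∈ p.bset ∧ -(N : ℤ) ≤ x := by
  simp only [Finset.mem_image, Finset.mem_range]
  constructor
  · rintro ⟨i, hi, rfl⟩
    refine ⟨⟨i, rfl⟩, ?_⟩
    unfold beta
    omega
  · rintro ⟨⟨i, rfl⟩, h⟩
    refine ⟨i, ?_, rfl⟩
    by_contra hc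
    unfold beta at h
    rw [hN i (by omega)] at h
    omega

/-- `m r` is the largest bead on the runner `r`. -/
def IsTop (s : ℕ) (p : YPartition) (m : ZMod s → ℤ) : Prop :=
  (∀ r, (m r : ZMod s) = r) ∧ ∀ x : ℤ, x ∈ p.bset ↔ x ≤ m (x : ZMod s)

lemma exists_isTop (p : YPartition) (s : ℕ) (hs : 0 < s)
    (h : ∀ x ∈ p.bset, x - s ∈ p.bset) : ∃ m : ZMod s → ℤ, IsTop s p m := by
  have : NeZero s := ⟨hs.ne'⟩
  obtain ⟨N, hN⟩ := p.finite_support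
  have hiter : ∀ k : ℕ, ∀ x ∈ p.bset, x - k * s ∈ p.bset := by
    intro k
    induction k with
    | zero => intro x hx; simpa using hx
    | succ k ih =>
      intro x hx
      have := h _ (ih x hx)
      convert this using 1
      push_cast; ring
  have hex : ∀ r : ZMod s, ∃ z : ℤ, (z ∈ p.bset ∧ (z : ZMod s) = r) ∧
      ∀ w : ℤ, (w ∈ p.bset ∧ (w : ZMod s) = r) → w ≤ z := by
    intro r
    apply Int.exists_greatest_of_bdd
    · refine ⟨p.beta 0, ?_⟩
      rintro z ⟨⟨i, rfl⟩, _⟩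
      exact p.beta_strictAnti.antitone (Nat.zero_le i)
    · refine ⟨(r.val : ℤ) - s * (N + 2), p.mem_bset_of_lt N hN _ ?_, by simp⟩
      have h1 : r.val < s := ZMod.val_lt r
      have h2 : (N : ℤ) ≤ s * N := by nlinarith
      have h3 : (r.val : ℤ) < s := by exact_mod_cast h1
      nlinarith
  choose m hm hmax using hex
  refine ⟨m, fun r => (hm r).2, fun x => ⟨fun hx => hmax _ x ⟨hx, rfl⟩, fun hx => ?_⟩⟩
  have hd : ((m (x : ZMod s) : ℤ) : ZMod s) = ((x : ℤ) : ZMod s) := (hm _).2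
  rw [ZMod.intCast_eq_intCast_iff_dvd_sub] at hd
  obtain ⟨c, hc⟩ := hd
  have hc' : 0 ≤ -c := by
    by_contra hcc
    have : (s : ℤ) * c > 0 := by apply mul_pos <;> omega
    omega
  obtain ⟨k, hk⟩ := Int.eq_ofNat_of_zero_le hc'
  have := hiter k _ (hm (x : ZMod s)).1
  convert this using 1
  have : c = -(k : ℤ) := by omega
  subst this
  linarith

lemma sum_top (p : YPartition) (s : ℕ) [NeZero s] (m : ZMod s → ℤ) (hm : IsTop s p m)
    (N : ℕ) (hN : ∀ i, N ≤ i → p.parts i = 0) (F : ℤ → ℤ) :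
    ∑ i ∈ Finset.range (N + s), F (p.beta i) =
      ∑ i ∈ Finset.range N, F (p.beta i - s) + ∑ r, F (m r) := by
  have hs : 0 < s := Nat.pos_of_ne_zero (NeZero.ne s)
  have hinj : Function.Injective m := by
    intro a b hab
    rw [← hm.1 a, ← hm.1 b, hab]
  have hinj2 : Function.Injective (fun i => p.beta i - s) := by
    intro a b hab
    apply p.beta_strictAnti.injective
    simpa using hab
  have hmem2 : ∀ x : ℤ, x ∈ (Finset.range N).image (fun i => p.beta i - s) ↔
      x + s ∈ p.bset ∧ -(N : ℤ) ≤ x + s := by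
    intro x
    rw [← p.mem_image_beta N hN]
    simp only [Finset.mem_image]
    constructor
    · rintro ⟨a, ha, rfl⟩; exact ⟨a, ha, by ring⟩
    · rintro ⟨a, ha, h⟩; exact ⟨a, ha, by rw [h]; ring⟩
  have hmem3 : ∀ x : ℤ, x ∈ (Finset.univ : Finset (ZMod s)).image m ↔
      x ∈ p.bset ∧ x + s ∉ p.bset := by
    intro x
    simp only [Finset.mem_image, Finset.mem_univ, true_and]
    rw [hm.2, hm.2]
    have hcast : ((x + s : ℤ) : ZMod s) = (x : ZMod s) := by simp
    rw [hcast]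
    constructor
    · rintro ⟨r, rfl⟩
      rw [hm.1]
      omega
    · rintro ⟨h1, h2⟩
      refine ⟨x, ?_⟩
      have hd := hm.1 (x : ZMod s)
      rw [eq_comm, ZMod.intCast_eq_intCast_iff_dvd_sub] at hd
      obtain ⟨c, hc⟩ := hd
      have : c < 1 := by
        by_contra hcc
        nlinarith
      have : c > -1 := by
        by_contra hcc
        nlinarith
      have : c = 0 := by omega
      subst this
      omega
  have hunion : (Finset.range (N + s)).image p.beta =
      (Finset.range N).image (fun i => p.beta i - s) ∪ (Finset.univ : Finset (ZMod s)).image m := by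
    ext x
    rw [Finset.mem_union, hmem2, hmem3, p.mem_image_beta (N + s) (fun i hi => hN i (by omega))]
    have hlow := p.mem_bset_of_lt N hN (x + s)
    have hcl : x + s ∈ p.bset → x ∈ p.bset := by
      rw [hm.2, hm.2]
      have hcast : ((x + s : ℤ) : ZMod s) = (x : ZMod s) := by simp
      rw [hcast]
      omega
    push_cast
    constructor
    · rintro ⟨h1, h2⟩
      by_cases h3 : x + s ∈ p.bset
      · left; exact ⟨h3, by omega⟩
      · right; exact ⟨h1, h3⟩
    · rintro (⟨h1, h2⟩ | ⟨h1, h2⟩)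
      · exact ⟨hcl h1, by omega⟩
      · refine ⟨h1, ?_⟩
        by_contra hc
        exact h2 (hlow (by omega))
  have hdisj : Disjoint ((Finset.range N).image (fun i => p.beta i - s))
      ((Finset.univ : Finset (ZMod s)).image m) := by
    rw [Finset.disjoint_left]
    intro x hx hx'
    rw [hmem2] at hx
    rw [hmem3] at hx'
    exact hx'.2 hx.1
  calc ∑ i ∈ Finset.range (N + s), F (p.beta i)
      = ∑ x ∈ (Finset.range (N + s)).image p.beta, F x := by
        rw [Finset.sum_image (fun a _ b _ h => p.beta_strictAnti.injective h)]
    _ = _ := by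
        rw [hunion, Finset.sum_union hdisj, Finset.sum_image (fun a _ b _ h => hinj2 h),
          Finset.sum_image (fun a _ b _ h => hinj h)]

lemma two_sum_id (s : ℕ) : 2 * ∑ i ∈ Finset.range s, (i : ℤ) = s * (s - 1) := by
  induction s with
  | zero => simp
  | succ n ih => rw [Finset.sum_range_succ, mul_add, ih]; push_cast; ring

lemma six_sum_sq (s : ℕ) :
    6 * ∑ i ∈ Finset.range s, (i : ℤ) ^ 2 = s * (s - 1) * (2 * s - 1) := by
  induction s with
  | zero => simp
  | succ n ih => rw [Finset.sum_range_succ, mul_add, ih]; push_cast; ring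

lemma top_sums (p : YPartition) (s : ℕ) [NeZero s] (m : ZMod s → ℤ) (hm : IsTop s p m) :
    2 * ∑ r, m r = -(s * (s + 1) : ℤ) ∧
    12 * s * (p.size : ℤ) = 6 * ∑ r, (m r) ^ 2 - s * (s + 1) * (2 * s + 1) := by
  obtain ⟨N, hN⟩ := p.finite_support
  have h1 := p.sum_top s m hm N hN (fun x => x)
  have h2 := p.sum_top s m hm N hN (fun x => x ^ 2)
  have hsz : (p.size : ℤ) = ∑ i ∈ Finset.range N, (p.parts i : ℤ) := by
    rw [p.size_eq N hN]; push_cast; rfl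
  have hb : ∀ i, p.beta (N + i) = -(N : ℤ) - 1 - i := by
    intro i
    unfold beta
    rw [hN _ (by omega)]
    push_cast; ring
  have hB : ∑ i ∈ Finset.range N, p.beta i
      = (p.size : ℤ) - ∑ i ∈ Finset.range N, (i : ℤ) - N := by
    rw [hsz]
    simp only [beta, Finset.sum_sub_distrib]
    simp
  rw [Finset.sum_range_add] at h1 h2
  simp only [hb] at h1 h2
  have e1 : ∑ i ∈ Finset.range s, (-(N : ℤ) - 1 - i) = s * (-(N : ℤ) - 1)
      - ∑ i ∈ Finset.range s, (i : ℤ) := by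
    rw [Finset.sum_sub_distrib]; simp; ring
  have e2 : ∑ i ∈ Finset.range s, (-(N : ℤ) - 1 - i) ^ 2 = s * (N + 1) ^ 2
      + 2 * (N + 1) * ∑ i ∈ Finset.range s, (i : ℤ) + ∑ i ∈ Finset.range s, (i : ℤ) ^ 2 := by
    rw [Finset.mul_sum]
    have : (s : ℤ) * (N + 1) ^ 2 = ∑ i ∈ Finset.range s, ((N : ℤ) + 1) ^ 2 := by simp
    rw [this, ← Finset.sum_add_distrib, ← Finset.sum_add_distrib]
    exact Finset.sum_congr rfl fun i _ => by ring
  have e3 : ∑ i ∈ Finset.range N, (p.beta i - s) = ∑ i ∈ Finset.range N, p.beta i - N * s := by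
    rw [Finset.sum_sub_distrib]; simp
  have e4 : ∑ i ∈ Finset.range N, (p.beta i - s) ^ 2 = ∑ i ∈ Finset.range N, (p.beta i) ^ 2
      - 2 * s * ∑ i ∈ Finset.range N, p.beta i + N * s ^ 2 := by
    rw [Finset.mul_sum]
    have : (N : ℤ) * s ^ 2 = ∑ i ∈ Finset.range N, (s : ℤ) ^ 2 := by simp
    rw [this, ← Finset.sum_sub_distrib, ← Finset.sum_add_distrib]
    exact Finset.sum_congr rfl fun i _ => by ring
  have f1 := two_sum_id s
  have f2 := six_sum_sq s
  have f3 := two_sum_id N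
  rw [e1, e3] at h1
  rw [e2, e4, hB] at h2
  constructor
  · linear_combination -2 * h1 - f1
  · linear_combination 6 * h2 - 6 * (N + 1) * f1 - f2 + 6 * s * f3

/-- The main quadratic estimate. -/
lemma quad_bound (s t : ℕ) [NeZero s] (hst : Nat.Coprime s t) (m : ZMod s → ℤ)
    (hm : ∀ r, m r - t ≤ m (r - t)) :
    (∀ k : ℕ, ∀ r, m r - k * t ≤ m (r - k * t)) ∧
    12 * s * ∑ r, (m r) ^ 2 ≤ 12 * (∑ r, m r) ^ 2 + t ^ 2 * s * (s * (s - 1) * (s + 1)) ∧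
    (12 * s * ∑ r, (m r) ^ 2 = 12 * (∑ r, m r) ^ 2 + t ^ 2 * s * (s * (s - 1) * (s + 1)) →
      ∀ r, (m (r - t) - m r + t) * ((s - 1) * t - (m (r - t) - m r)) = 0) := by
  have hs : 0 < s := Nat.pos_of_ne_zero (NeZero.ne s)
  have hit : ∀ k : ℕ, ∀ r, m r - k * t ≤ m (r - k * t) := by
    intro k
    induction k with
    | zero => intro r; simp
    | succ k ih =>
      intro r
      have h1 := ih r
      have h2 := hm (r - k * t)
      have : r - ((k + 1 : ℕ) : ZMod s) * t = r - k * t - t := by push_cast; ring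
      rw [this]
      push_cast
      linarith
  refine ⟨hit, ?_⟩
  set g : ℕ → ZMod s → ℤ := fun k r =>
    (m (r - ((k + 1 : ℕ) : ZMod s) * t) - m r + ((k + 1 : ℕ) : ℤ) * t) *
    ((s - ((k + 1 : ℕ) : ℤ)) * t - (m (r - ((k + 1 : ℕ) : ZMod s) * t) - m r)) with hg
  have hg0 : ∀ k ∈ Finset.range s, ∀ r, 0 ≤ g k r := by
    intro k hk r
    rw [Finset.mem_range] at hk
    have h1 := hit (k + 1) r
    have h2 := hit (s - (k + 1)) (r - ((k + 1 : ℕ) : ZMod s) * t)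
    have h3 : r - ((k + 1 : ℕ) : ZMod s) * t - ((s - (k + 1) : ℕ) : ZMod s) * t = r := by
      rw [Nat.cast_sub (by omega)]
      simp
      ring
    rw [h3] at h2
    have h4 : ((s - (k + 1) : ℕ) : ℤ) = s - ((k + 1 : ℕ) : ℤ) := by
      rw [Nat.cast_sub (by omega)]
    rw [h4] at h2
    apply mul_nonneg <;> linarith
  -- sum over r for fixed k
  have hshift : ∀ (c : ZMod s) (F : ZMod s → ℤ), ∑ r, F (r - c) = ∑ r, F r := by
    intro c F
    exact Equiv.sum_comp (Equiv.subRight c) F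
  have hu : IsUnit (t : ZMod s) := by
    rw [ZMod.isUnit_iff_coprime]; exact hst.symm
  have hperm : ∀ (r : ZMod s) (F : ZMod s → ℤ),
      ∑ k ∈ Finset.range s, F (r - ((k + 1 : ℕ) : ZMod s) * t) = ∑ r, F r := by
    intro r F
    have h1 : ∀ G : ZMod s → ℤ, ∑ k ∈ Finset.range s, G (k : ZMod s) = ∑ r, G r := by
      intro G
      refine Finset.sum_bij (fun k _ => (k : ZMod s)) (fun _ _ => Finset.mem_univ _) ?_ ?_
        (fun _ _ => rfl)
      · intro a ha b hb hab
        rw [Finset.mem_range] at ha hb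
        rw [ZMod.natCast_eq_natCast_iff'] at hab
        rwa [Nat.mod_eq_of_lt ha, Nat.mod_eq_of_lt hb] at hab
      · intro b _
        exact ⟨b.val, Finset.mem_range.2 (ZMod.val_lt b), by simp⟩
    have h2 := h1 (fun c => F (r - (c + 1) * t))
    push_cast
    rw [h2]
    refine Fintype.sum_bijective (fun c : ZMod s => r - (c + 1) * t) ?_ _ _ (fun _ => rfl)
    rw [← Finite.injective_iff_bijective]
    intro a b hab
    have : a * t = b * t := by linear_combination -hab
    exact hu.mul_right_cancel this
  have hexp : ∀ k r, g k r = ((s : ℤ) - 2 * (k + 1)) * t * (m (r - ((k + 1 : ℕ) : ZMod s) * t) - m r)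
      + (k + 1) * (s - (k + 1)) * t ^ 2
      - (m (r - ((k + 1 : ℕ) : ZMod s) * t)) ^ 2 - (m r) ^ 2
      + 2 * (m r * m (r - ((k + 1 : ℕ) : ZMod s) * t)) := by
    intro k r
    simp only [hg]
    push_cast
    ring
  have hcard : (Fintype.card (ZMod s) : ℤ) = s := by rw [ZMod.card]
  have hsumk : ∀ k, ∑ r, g k r = s * ((k + 1) * (s - (k + 1)) * t ^ 2) - 2 * ∑ r, (m r) ^ 2
      + 2 * ∑ r, m r * m (r - ((k + 1 : ℕ) : ZMod s) * t) := by
    intro k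
    simp only [hexp]
    rw [Finset.sum_add_distrib, Finset.sum_sub_distrib, Finset.sum_sub_distrib,
      Finset.sum_add_distrib, ← Finset.mul_sum, ← Finset.mul_sum, Finset.sum_sub_distrib,
      hshift _ m, hshift _ (fun r => (m r) ^ 2), Finset.sum_const, Finset.card_univ, nsmul_eq_mul,
      hcard, ← Finset.mul_sum]
    ring
  have hcross : ∑ k ∈ Finset.range s, ∑ r, m r * m (r - ((k + 1 : ℕ) : ZMod s) * t)
      = (∑ r, m r) ^ 2 := by
    rw [Finset.sum_comm]
    simp only [← Finset.mul_sum]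
    simp only [hperm _ m]
    rw [← Finset.sum_mul, sq]
  have hpoly : ∀ (n : ℕ) (a : ℤ), 6 * ∑ k ∈ Finset.range n, ((k : ℤ) + 1) * (a - (k + 1))
      = n * (n + 1) * (3 * a - 2 * n - 1) := by
    intro n a
    induction n with
    | zero => simp
    | succ n ih => rw [Finset.sum_range_succ, mul_add, ih]; push_cast; ring
  have htot : 6 * ∑ k ∈ Finset.range s, ∑ r, g k r =
      12 * (∑ r, m r) ^ 2 + t ^ 2 * s * (s * (s - 1) * (s + 1)) - 12 * s * ∑ r, (m r) ^ 2 := by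
    simp only [hsumk]
    rw [Finset.sum_add_distrib, Finset.sum_sub_distrib, ← Finset.mul_sum, ← Finset.mul_sum,
      ← Finset.mul_sum, hcross,
      ← Finset.sum_mul, Finset.sum_const, Finset.card_range, nsmul_eq_mul]
    have := hpoly s s
    linear_combination (s * t ^ 2 : ℤ) * this
  have hnn : 0 ≤ ∑ k ∈ Finset.range s, ∑ r, g k r :=
    Finset.sum_nonneg fun k hk => Finset.sum_nonneg fun r _ => hg0 k hk r
  refine ⟨by linarith, ?_⟩
  intro heq r
  have hz : ∑ k ∈ Finset.range s, ∑ r, g k r = 0 := by linarith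
  rw [Finset.sum_eq_zero_iff_of_nonneg
    (fun k hk => Finset.sum_nonneg fun r _ => hg0 k hk r)] at hz
  have hz0 := hz 0 (Finset.mem_range.2 hs)
  rw [Finset.sum_eq_zero_iff_of_nonneg (fun r _ => hg0 0 (Finset.mem_range.2 hs) r)] at hz0
  have := hz0 r (Finset.mem_univ _)
  simpa [hg] using this

/-- The extremal beta set. -/
def kset (s t : ℕ) : Set ℤ :=
  {x | ∃ a b : ℕ, 2 * x = (s * t - s - t - 1 : ℤ) - 2 * (a * s + b * t)}

lemma zmod_repr (s t : ℕ) [NeZero s] (hst : Nat.Coprime s t) (c : ZMod s) :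
    ∃ k < s, (k : ZMod s) * t = c := by
  have hu : IsUnit (t : ZMod s) := by
    rw [ZMod.isUnit_iff_coprime]; exact hst.symm
  obtain ⟨u, hu⟩ := hu
  refine ⟨(c * (u⁻¹ : (ZMod s)ˣ) : ZMod s).val, ZMod.val_lt _, ?_⟩
  rw [ZMod.natCast_zmod_val, ← hu]
  simp

lemma sum_repr (s t : ℕ) [NeZero s] (hst : Nat.Coprime s t) (j : ZMod s) (F : ZMod s → ℤ) :
    ∑ k ∈ Finset.range s, F (j - (k : ZMod s) * t) = ∑ r, F r := by
  have hu : IsUnit (t : ZMod s) := by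
    rw [ZMod.isUnit_iff_coprime]; exact hst.symm
  refine Finset.sum_bij (fun k _ => j - (k : ZMod s) * t) (fun _ _ => Finset.mem_univ _) ?_ ?_
    (fun _ _ => rfl)
  · intro a ha b hb hab
    rw [Finset.mem_range] at ha hb
    have hab : (a : ZMod s) * t = b * t := by linear_combination -hab
    have hab := hu.mul_right_cancel hab
    rw [ZMod.natCast_eq_natCast_iff'] at hab
    rwa [Nat.mod_eq_of_lt ha, Nat.mod_eq_of_lt hb] at hab
  · intro b _
    obtain ⟨k, hk, h⟩ := zmod_repr s t hst (j - b)
    exact ⟨k, Finset.mem_range.2 hk, by rw [h]; ring⟩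

/-- If the tops form an arithmetic progression, everything is determined. -/
lemma bset_of_prog (s t : ℕ) [NeZero s] (hst : Nat.Coprime s t) (p : YPartition)
    (m : ZMod s → ℤ) (hm : IsTop s p m) (j : ZMod s)
    (hj : ∀ k < s, m (j - (k : ZMod s) * t) = m j - k * t) :
    2 * m j = (s * t - s - t - 1 : ℤ) ∧
    24 * (p.size : ℤ) = ((s : ℤ) ^ 2 - 1) * ((t : ℤ) ^ 2 - 1) := by
  have hs : 0 < s := Nat.pos_of_ne_zero (NeZero.ne s)
  obtain ⟨h1, h2⟩ := p.top_sums s m hm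
  rw [← sum_repr s t hst j m, Finset.sum_congr rfl (fun k hk => hj k (Finset.mem_range.1 hk)),
    Finset.sum_sub_distrib, ← Finset.sum_mul] at h1
  rw [← sum_repr s t hst j (fun r => (m r) ^ 2),
    Finset.sum_congr rfl (fun k hk => by rw [hj k (Finset.mem_range.1 hk)])] at h2
  have f1 := two_sum_id s
  have f2 := six_sum_sq s
  have e2 : ∑ k ∈ Finset.range s, (m j - k * t) ^ 2 = s * (m j) ^ 2
      - 2 * m j * t * ∑ i ∈ Finset.range s, (i : ℤ)
      + t ^ 2 * ∑ i ∈ Finset.range s, (i : ℤ) ^ 2 := by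
    rw [Finset.mul_sum, Finset.mul_sum]
    have : (s : ℤ) * (m j) ^ 2 = ∑ i ∈ Finset.range s, (m j) ^ 2 := by simp
    rw [this, ← Finset.sum_sub_distrib, ← Finset.sum_add_distrib]
    exact Finset.sum_congr rfl fun i _ => by ring
  have hs' : (s : ℤ) ≠ 0 := by exact_mod_cast hs.ne'
  simp only [Finset.sum_const, Finset.card_range, nsmul_eq_mul] at h1
  have hM : 2 * m j = (s * t - s - t - 1 : ℤ) := by
    apply mul_left_cancel₀ hs'
    linear_combination h1 + t * f1
  refine ⟨hM, ?_⟩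
  rw [e2] at h2
  apply mul_left_cancel₀ hs'
  have hM2 : 4 * (m j) ^ 2 = (s * t - s - t - 1 : ℤ) ^ 2 := by rw [← hM]; ring
  linear_combination 2 * h2 - 12 * m j * t * f1 + 2 * t ^ 2 * f2 + 3 * s * hM2 - 6 * t * s * (s - 1) * hM

lemma core_bound (s t : ℕ) (hs : 0 < s) (ht : 0 < t) (hst : Nat.Coprime s t) (p : YPartition)
    (h1 : IsCore s p) (h2 : IsCore t p) :
    24 * (p.size : ℤ) ≤ ((s : ℤ) ^ 2 - 1) * ((t : ℤ) ^ 2 - 1) ∧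
    (24 * (p.size : ℤ) = ((s : ℤ) ^ 2 - 1) * ((t : ℤ) ^ 2 - 1) → p.bset = kset s t) := by
  have : NeZero s := ⟨hs.ne'⟩
  rw [isCore_iff _ _ hs] at h1
  rw [isCore_iff _ _ ht] at h2
  obtain ⟨m, hm⟩ := p.exists_isTop s hs h1
  have hmt : ∀ r, m r - t ≤ m (r - t) := by
    intro r
    have : m r ∈ p.bset := by rw [hm.2, hm.1]
    have := h2 _ this
    rw [hm.2] at this
    push_cast at this
    rwa [hm.1] at this
  obtain ⟨hit, hb, heq⟩ := quad_bound s t hst m hmt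
  obtain ⟨g1, g2⟩ := p.top_sums s m hm
  have hs' : (0 : ℤ) < s := by exact_mod_cast hs
  have g1' : 4 * (∑ r, m r) ^ 2 = (s * (s + 1) : ℤ) ^ 2 := by
    have : (2 * ∑ r, m r) ^ 2 = (-(s * (s + 1) : ℤ)) ^ 2 := by rw [g1]
    linarith
  have key : (s : ℤ) * s * (((s : ℤ) ^ 2 - 1) * ((t : ℤ) ^ 2 - 1) - 24 * (p.size : ℤ)) =
      12 * (∑ r, m r) ^ 2 + t ^ 2 * s * (s * (s - 1) * (s + 1)) - 12 * s * ∑ r, (m r) ^ 2 := by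
    linear_combination -2 * s * g2 - 3 * g1'
  constructor
  · by_contra hc
    push Not at hc
    have : (s : ℤ) * s * (((s : ℤ) ^ 2 - 1) * ((t : ℤ) ^ 2 - 1) - 24 * (p.size : ℤ)) < 0 :=
      mul_neg_of_pos_of_neg (mul_pos hs' hs') (by linarith)
    linarith
  · intro he
    have hz := heq (by rw [he] at key; linarith)
    have hex : ∃ r, m (r - t) - m r = (s - 1) * t := by
      by_contra hcon
      push Not at hcon
      have hall : ∀ r, m (r - t) = m r - t := by
        intro r
        rcases mul_eq_zero.1 (hz r) with h | h
        · linarith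
        · exact absurd (by linarith) (hcon r)
      have hsum : ∑ r, m (r - t) = ∑ r, m r := Equiv.sum_comp (Equiv.subRight (t : ZMod s)) m
      simp only [hall] at hsum
      rw [Finset.sum_sub_distrib, Finset.sum_const, Finset.card_univ, ZMod.card,
        nsmul_eq_mul] at hsum
      have : (0 : ℤ) < s * t := by positivity
      linarith
    obtain ⟨r, hr⟩ := hex
    have hprog : ∀ k < s, m (r - t - (k : ZMod s) * t) = m (r - t) - k * t := by
      intro k hk
      have a1 := hit k (r - t)
      have a2 := hit (s - 1 - k) (r - t - (k : ZMod s) * t)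
      have a3 : r - t - (k : ZMod s) * t - ((s - 1 - k : ℕ) : ZMod s) * t = r := by
        rw [Nat.cast_sub (by omega), Nat.cast_sub (by omega)]
        simp; ring
      have a4 : ((s - 1 - k : ℕ) : ℤ) = s - 1 - k := by omega
      rw [a3, a4] at a2
      linarith
    obtain ⟨hM, -⟩ := bset_of_prog s t hst p m hm (r - t) hprog
    ext x
    rw [hm.2]
    constructor
    · intro hx
      obtain ⟨k, hk, hk2⟩ := zmod_repr s t hst (r - t - (x : ZMod s))
      have e : (x : ZMod s) = r - t - (k : ZMod s) * t := by rw [hk2]; ring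
      have e2 := hprog k hk
      rw [← e] at e2
      have hd := hm.1 (x : ZMod s)
      rw [eq_comm, ZMod.intCast_eq_intCast_iff_dvd_sub] at hd
      obtain ⟨c, hc⟩ := hd
      have hc0 : 0 ≤ c := by
        by_contra hcc
        have : (s : ℤ) * c < 0 := mul_neg_of_pos_of_neg hs' (by omega)
        omega
      obtain ⟨a, rfl⟩ := Int.eq_ofNat_of_zero_le hc0
      refine ⟨a, k, ?_⟩
      linear_combination -2 * hc + 2 * e2 + hM
    · rintro ⟨a, b, hab⟩
      have e : x = m (r - t) - a * s - b * t := by linarith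
      have e1 : (x : ZMod s) = r - t - (b : ZMod s) * t := by
        rw [e]; push_cast; rw [hm.1]; simp
      have := hit b (r - t)
      rw [← e1] at this
      have : (0 : ℤ) ≤ a * s := by positivity
      linarith

/-- Any symmetric set of integers which is bounded above is the beta set of a
self-conjugate partition. -/
lemma exists_of_symm (S : Set ℤ) (L : ℕ) (hL : ∀ x ∈ S, x < L)
    (hsym : ∀ x, x ∈ S ↔ -1 - x ∉ S) : ∃ p : YPartition, p.bset = S ∧ p.SelfConj := by
  classical
  set P : ℕ → Prop := fun n => (L : ℤ) - 1 - n ∈ S with hP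
  have hbig : ∀ n, 2 * L ≤ n → P n := by
    intro n hn
    simp only [hP]
    rw [hsym]
    intro h
    have := hL _ h
    omega
  have hinf : (Set.ofPred P).Infinite := by
    rw [Set.infinite_iff_exists_gt]
    intro a
    exact ⟨a + 2 * L + 1, hbig _ (by omega), by omega⟩
  have hcount : Nat.count P (2 * L) = L := by
    have h1 : ∑ i ∈ Finset.range (2 * L), (if P (2 * L - 1 - i) then 1 else 0)
        = ∑ i ∈ Finset.range (2 * L), (if P i then 1 else 0) :=
      Finset.sum_range_reflect (fun i => if P i then 1 else 0) (2 * L)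
    have h2 : ∀ i ∈ Finset.range (2 * L), (if P (2 * L - 1 - i) then 1 else 0)
        + (if P i then 1 else 0) = 1 := by
      intro i hi
      rw [Finset.mem_range] at hi
      have : P i ↔ ¬ P (2 * L - 1 - i) := by
        simp only [hP]
        rw [hsym]
        have : -1 - ((L : ℤ) - 1 - i) = (L : ℤ) - 1 - ((2 * L - 1 - i : ℕ) : ℤ) := by omega
        rw [this]
      by_cases h : P i
      · have := this.1 h
        simp [h, this]
      · have h' : P (2 * L - 1 - i) := by
          by_contra hc
          exact h (this.2 hc)
        simp [h, h']
    have h3 := Finset.sum_congr rfl h2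
    rw [Finset.sum_add_distrib, h1] at h3
    rw [Nat.count_eq_card_filter_range, Finset.card_filter]
    simp only [Finset.sum_const, Finset.card_range, smul_eq_mul] at h3
    omega
  have hcount2 : ∀ j, Nat.count P (2 * L + j) = L + j := by
    intro j
    induction j with
    | zero => simpa using hcount
    | succ j ih =>
      rw [← add_assoc, Nat.count_succ, ih, if_pos (hbig _ (by omega))]
      omega
  have hnth : ∀ j, Nat.nth P (L + j) = 2 * L + j := by
    intro j
    rw [← hcount2 j]
    exact Nat.nth_count (hbig _ (by omega))
  have hmono : StrictMono (Nat.nth P) := Nat.nth_strictMono hinf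
  have hstep : ∀ i d, Nat.nth P i + d ≤ Nat.nth P (i + d) := by
    intro i d
    induction d with
    | zero => simp
    | succ d ih =>
      have := hmono (show i + d < i + (d + 1) by omega)
      omega
  have hle : ∀ i, Nat.nth P i ≤ L + i := by
    intro i
    have h1 := hstep i L
    have h2 := hnth i
    rw [add_comm L i] at h2
    omega
  let p : YPartition :=
    { parts := fun i => L + i - Nat.nth P i
      antitone := by
        intro i j hij
        have := hstep i (j - i)
        rw [Nat.add_sub_cancel' hij] at this
        omega
      finite_support := by
        refine ⟨L, fun i hi => ?_⟩
        have := hnth (i - L)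
        rw [Nat.add_sub_cancel' hi] at this
        omega }
  have hbeta : ∀ i, p.beta i = (L : ℤ) - 1 - Nat.nth P i := by
    intro i
    have := hle i
    simp only [beta, p]
    omega
  have hbs : p.bset = S := by
    ext x
    constructor
    · rintro ⟨i, rfl⟩
      rw [hbeta]
      exact Nat.nth_mem_of_infinite hinf i
    · intro hx
      have hlt := hL x hx
      have hx' : P ((L : ℤ) - 1 - x).toNat := by
        simp only [hP]
        convert hx using 1
        omega
      refine ⟨Nat.count P ((L : ℤ) - 1 - x).toNat, ?_⟩
      rw [hbeta, Nat.nth_count hx']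
      omega
  refine ⟨p, hbs, ?_⟩
  let q : YPartition :=
    { parts := p.conj
      antitone := by
        intro i j hij
        by_contra hc
        push Not at hc
        rw [lt_conj_iff] at hc
        have : ¬ p.conj i < p.conj i := lt_irrefl _
        rw [lt_conj_iff] at this
        omega
      finite_support := by
        refine ⟨p.parts 0, fun i hi => ?_⟩
        by_contra hc
        have : 0 < p.conj i := by omega
        rw [lt_conj_iff] at this
        omega }
  have hq : q = p := by
    apply eq_of_bset_eq
    rw [hbs]
    ext x
    rw [hsym, ← hbs]
    constructor
    · rintro ⟨j, rfl⟩ ⟨i, hi⟩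
      apply p.beta_ne i j
      rw [hi]
      simp only [beta, q]
      ring
    · intro hx
      obtain ⟨j, hj⟩ := p.exists_of_notMem _ hx
      refine ⟨j, ?_⟩
      simp only [beta, q]
      linarith
  intro j
  exact congrFun (congrArg YPartition.parts hq) j

lemma kset_symm (s t : ℕ) (hs : 0 < s) (ht : 0 < t) (hst : Nat.Coprime s t) (x : ℤ) :
    x ∈ kset s t ↔ -1 - x ∉ kset s t := by
  have : NeZero s := ⟨hs.ne'⟩
  constructor
  · rintro ⟨a, b, h⟩ ⟨a', b', h'⟩
    apply Nat.Coprime.mul_add_mul_ne_mul hst (a := a + a' + 1) (b := b + b' + 1)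
      (by omega) (by omega)
    zify
    linarith
  · intro hx
    -- the parity of `s t - s - t - 1`
    have hpar : ∃ M : ℤ, 2 * M = (s * t - s - t - 1 : ℤ) := by
      rcases Nat.even_or_odd s with h | h
      · rcases Nat.even_or_odd t with h' | h'
        · exfalso
          have := Nat.dvd_gcd h.two_dvd h'.two_dvd
          rw [hst] at this
          omega
        · obtain ⟨c, hc⟩ := h'
          refine ⟨s * c - c - 1, ?_⟩
          rw [hc]; push_cast; ring
      · obtain ⟨c, hc⟩ := h
        refine ⟨c * t - c - 1, ?_⟩
        rw [hc]; push_cast; ring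
    obtain ⟨M, hM⟩ := hpar
    obtain ⟨k, hk, hk2⟩ := zmod_repr s t hst ((M - x : ℤ) : ZMod s)
    have hk3 : ((k * t : ℤ) : ZMod s) = ((M - x : ℤ) : ZMod s) := by
      rw [← hk2]; push_cast; ring
    rw [ZMod.intCast_eq_intCast_iff_dvd_sub] at hk3
    obtain ⟨c, hc⟩ := hk3
    rcases le_or_gt 0 c with h | h
    · obtain ⟨a, rfl⟩ := Int.eq_ofNat_of_zero_le h
      refine ⟨a, k, ?_⟩
      linear_combination -2 * hc + hM
    · exfalso
      apply hx
      refine ⟨(-1 - c).toNat, s - 1 - k, ?_⟩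
      have e1 : (((-1 - c).toNat : ℕ) : ℤ) = -1 - c := by omega
      have e2 : ((s - 1 - k : ℕ) : ℤ) = s - 1 - k := by omega
      rw [e1, e2]
      linear_combination 2 * hc - hM

lemma kset_size (s t : ℕ) (hs : 0 < s) (ht : 0 < t) (hst : Nat.Coprime s t) (p : YPartition)
    (hp : p.bset = kset s t) :
    24 * (p.size : ℤ) = ((s : ℤ) ^ 2 - 1) * ((t : ℤ) ^ 2 - 1) := by
  have : NeZero s := ⟨hs.ne'⟩
  have hs' : (0 : ℤ) < s := by exact_mod_cast hs
  have h1 : ∀ x ∈ p.bset, x - s ∈ p.bset := by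
    rw [hp]
    rintro x ⟨a, b, h⟩
    exact ⟨a + 1, b, by push_cast; linarith⟩
  obtain ⟨m, hm⟩ := p.exists_isTop s hs h1
  have hpar : ∃ M : ℤ, 2 * M = (s * t - s - t - 1 : ℤ) := by
    obtain ⟨x, a, b, h⟩ : ∃ x, x ∈ kset s t := by
      rw [← hp]; exact ⟨_, 0, rfl⟩
    exact ⟨x + (a * s + b * t), by linarith⟩
  obtain ⟨M, hM⟩ := hpar
  have htop : ∀ k < s, m ((M : ZMod s) - (k : ZMod s) * t) = M - k * t := by
    intro k hk
    have hcast : ((M - k * t : ℤ) : ZMod s) = (M : ZMod s) - (k : ZMod s) * t := by push_cast; ring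
    have hmem : (M - k * t : ℤ) ∈ p.bset := by
      rw [hp]; exact ⟨0, k, by push_cast; linarith⟩
    have hnot : (M - k * t + s : ℤ) ∉ p.bset := by
      rw [hp, kset_symm s t hs ht hst, not_not]
      refine ⟨0, s - 1 - k, ?_⟩
      have e2 : ((s - 1 - k : ℕ) : ℤ) = s - 1 - k := by omega
      rw [e2]
      push_cast
      linear_combination -hM
    rw [hm.2] at hmem hnot
    have hcast2 : ((M - k * t + s : ℤ) : ZMod s) = (M : ZMod s) - (k : ZMod s) * t := by
      push_cast; simp
    rw [hcast] at hmem
    rw [hcast2] at hnot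
    have hd : ((M - k * t : ℤ) : ZMod s) = ((m ((M : ZMod s) - (k : ZMod s) * t) : ℤ) : ZMod s) := by
      rw [hm.1, hcast]
    rw [ZMod.intCast_eq_intCast_iff_dvd_sub] at hd
    obtain ⟨c, hc⟩ := hd
    have h3 : c < 1 := by
      by_contra hcc
      nlinarith
    have h4 : c > -1 := by
      by_contra hcc
      nlinarith
    have h5 : c = 0 := by omega
    subst h5
    linarith
  have hM0 : m (M : ZMod s) = M := by simpa using htop 0 hs
  refine (bset_of_prog s t hst p m hm (M : ZMod s) ?_).2
  intro k hk
  rw [htop k hk, hM0]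

end YPartition

open YPartition in
/-- (Olsson–Stanton) For coprime `s, t`, there is a unique `(s,t)`-core partition of
largest size; it is self-conjugate and its size is `(s²−1)(t²−1)/24`. -/
theorem largest_st_core (s t : ℕ) (hs : 0 < s) (ht : 0 < t) (hst : Nat.Coprime s t) :
    ∃ l : YPartition, IsCore s l ∧ IsCore t l ∧ l.SelfConj ∧
      24 * l.size = (s ^ 2 - 1) * (t ^ 2 - 1) ∧
      ∀ p : YPartition, IsCore s p → IsCore t p → p ≠ l → p.size < l.size := by
  obtain ⟨l, hl, hself⟩ := exists_of_symm (kset s t) (s * t) (by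
    rintro x ⟨a, b, h⟩
    have h1 : (0 : ℤ) ≤ a * s := by positivity
    have h2 : (0 : ℤ) ≤ b * t := by positivity
    have h3 : (0 : ℤ) < s * t := by positivity
    push_cast
    linarith) (kset_symm s t hs ht hst)
  have hsize := kset_size s t hs ht hst l hl
  refine ⟨l, ?_, ?_, hself, ?_, ?_⟩
  · rw [isCore_iff _ _ hs, hl]
    rintro x ⟨a, b, h⟩
    exact ⟨a + 1, b, by push_cast; linarith⟩
  · rw [isCore_iff _ _ ht, hl]
    rintro x ⟨a, b, h⟩
    exact ⟨a, b + 1, by push_cast; linarith⟩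
  · have h1 : 1 ≤ s ^ 2 := Nat.one_le_pow _ _ hs
    have h2 : 1 ≤ t ^ 2 := Nat.one_le_pow _ _ ht
    zify [h1, h2]
    exact hsize
  · intro p hps hpt hne
    obtain ⟨hb, heq⟩ := core_bound s t hs ht hst p hps hpt
    rcases lt_or_eq_of_le hb with h | h
    · omega
    · exact absurd (eq_of_bset_eq ((heq h).trans hl.symm)) hne
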